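/- Let X ~ CN(0, ρI_n) (complex Gaussian input with i.i.d. entries of variance ρ), Z ~ CN(0, I_n) independent of X, Y = X + Z. Define the information density i(X;Y) = ln(W(Y|X)/(P̄W)(Y)), where W(·|x) = CN(x, I_n) and P̄W = CN(0, (1+ρ)I_n). Then i(X;Y) = n·ln(1+ρ) + Σ_{i=1}^n ζ_i where the ζ_i are i.i.d., each distributed as λ(|U|² - |V|²) with U,V independent standard complex Gaussians and λ = √(ρ/(1+ρ)); consequently E[ζ] = 0, Var(ζ) = 2ρ/(1+ρ), and E[|ζ|³] = 6(ρ/(1+ρ))^{3/2}. -/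

import Mathlib

open Real MeasureTheory

/-- The circularly symmetric complex Gaussian measure CN(0, v) on ℂ,
with density z ↦ (π v)⁻¹ exp(-‖z‖²/v) w.r.t. Lebesgue measure. -/
noncomputable def complexGaussian (v : ℝ) : Measure ℂ :=
  (volume : Measure ℂ).withDensity
    (fun z => ENNReal.ofReal ((Real.pi * v)⁻¹ * Real.exp (-‖z‖ ^ 2 / v)))

/-- Per-coordinate term of the information density:
ζ = ‖x‖²/(1+ρ) - ρ‖z‖²/(1+ρ) + (2/(1+ρ)) Re(x z̄). -/
noncomputable def zetaTerm (ρ : ℝ) (x z : ℂ) : ℝ :=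
  ‖x‖ ^ 2 / (1 + ρ) - ρ * ‖z‖ ^ 2 / (1 + ρ) +
    (2 / (1 + ρ)) * (x * (starRingEnd ℂ) z).re

/-- Conditional channel density W(y|x) = ∏ᵢ π⁻¹ exp(-‖yᵢ - xᵢ‖²). -/
noncomputable def Wdens {n : ℕ} (x y : Fin n → ℂ) : ℝ :=
  ∏ i : Fin n, Real.pi⁻¹ * Real.exp (-‖y i - x i‖ ^ 2)

/-- Output density (P̄W)(y) = ∏ᵢ (π(1+ρ))⁻¹ exp(-‖yᵢ‖²/(1+ρ)). -/
noncomputable def outDens {n : ℕ} (ρ : ℝ) (y : Fin n → ℂ) : ℝ :=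
  ∏ i : Fin n, (Real.pi * (1 + ρ))⁻¹ * Real.exp (-‖y i‖ ^ 2 / (1 + ρ))

theorem MeasureTheory.MeasurePreserving.withDensity_comp {α β : Type*} [MeasurableSpace α]
    [MeasurableSpace β] {μ : Measure α} {ν : Measure β} {T : α → β}
    (hT : MeasurePreserving T μ ν) {g : β → ENNReal} (hg : Measurable g) :
    MeasurePreserving T (μ.withDensity fun a => g (T a)) (ν.withDensity g) := by
  refine ⟨hT.measurable, Measure.ext fun s hs => ?_⟩
  rw [Measure.map_apply hT.measurable hs, withDensity_apply _ (hT.measurable hs),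
    withDensity_apply _ hs, hT.setLIntegral_comp_preimage hs hg]

/-- A linear involution preserves Haar measure. -/
theorem LinearMap.measurePreserving_of_involutive {E : Type*} [NormedAddCommGroup E]
    [NormedSpace ℝ E] [FiniteDimensional ℝ E] [MeasurableSpace E] [BorelSpace E]
    (μ : Measure E) [μ.IsAddHaarMeasure] (L : E →ₗ[ℝ] E) (hL : Function.Involutive L) :
    MeasurePreserving L μ μ := by
  have hcomp : L ∘ₗ L = LinearMap.id := LinearMap.ext hL
  have hdet : LinearMap.det L * LinearMap.det L = 1 := by
    rw [← LinearMap.det_comp, hcomp, LinearMap.det_id]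
  have habs : |LinearMap.det L| = 1 := by
    rw [← pow_eq_one_iff_of_nonneg (abs_nonneg _) two_ne_zero, sq_abs, sq, hdet]
  refine ⟨L.continuous_of_finiteDimensional.measurable, ?_⟩
  rw [Measure.map_linearMap_addHaar_eq_smul_addHaar _ (left_ne_zero_of_mul_eq_one hdet),
    abs_inv, habs]
  simp

instance complexGaussian.instSFinite (v : ℝ) : SFinite (complexGaussian v) := by
  unfold complexGaussian
  infer_instance

/-- Scaling a standard complex Gaussian by `√ρ` gives variance `ρ`. -/
theorem measurePreserving_sqrt_smul_complexGaussian {ρ : ℝ} (hρ : 0 < ρ) :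
    MeasurePreserving (fun u : ℂ => √ρ • u) (complexGaussian 1) (complexGaussian ρ) := by
  have hvol : MeasurePreserving (fun u : ℂ => √ρ • u) volume
      (ENNReal.ofReal ρ⁻¹ • (volume : Measure ℂ)) := by
    refine ⟨by fun_prop, ?_⟩
    rw [Measure.map_addHaar_smul _ (Real.sqrt_pos.2 hρ).ne', Complex.finrank_real_complex,
      Real.sq_sqrt hρ.le, abs_of_pos (inv_pos.2 hρ)]
  have h := hvol.withDensity_comp
    (g := fun z => ENNReal.ofReal (π⁻¹ * Real.exp (-‖z‖ ^ 2 / ρ))) (by fun_prop)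
  have hsource : complexGaussian 1 = (volume : Measure ℂ).withDensity
      fun u => ENNReal.ofReal (π⁻¹ * Real.exp (-‖√ρ • u‖ ^ 2 / ρ)) := by
    unfold complexGaussian
    congr 1
    ext u
    rw [norm_smul, mul_pow, Real.norm_of_nonneg (Real.sqrt_nonneg ρ), Real.sq_sqrt hρ.le]
    congr 3
    · simp
    · field_simp
  have htarget : complexGaussian ρ = (ENNReal.ofReal ρ⁻¹ • (volume : Measure ℂ)).withDensity
      fun z => ENNReal.ofReal (π⁻¹ * Real.exp (-‖z‖ ^ 2 / ρ)) := by
    rw [withDensity_smul_measure, ← withDensity_smul _ (by fun_prop)]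
    unfold complexGaussian
    congr 1
    ext u
    rw [Pi.smul_apply, smul_eq_mul, ← ENNReal.ofReal_mul (inv_nonneg.2 hρ.le)]
    congr 1
    field_simp
  rw [hsource, htarget]
  exact h

theorem complexGaussian_one_prod :
    (complexGaussian 1).prod (complexGaussian 1) = ((volume : Measure ℂ).prod volume).withDensity
      fun p => ENNReal.ofReal ((π ^ 2)⁻¹ * Real.exp (-(‖p.1‖ ^ 2 + ‖p.2‖ ^ 2))) := by
  unfold complexGaussian
  rw [prod_withDensity (by fun_prop) (by fun_prop)]
  congr 1
  ext p
  rw [← ENNReal.ofReal_mul (by positivity)]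
  congr 1
  rw [neg_add, Real.exp_add]
  simp only [mul_one, div_one]
  ring

/-- The reflection `(u, v) ↦ (a u + b v, b u - a v)` of `ℂ × ℂ`. -/
noncomputable def reflection₂ (a b : ℝ) : ℂ × ℂ →ₗ[ℝ] ℂ × ℂ where
  toFun p := (a • p.1 + b • p.2, b • p.1 - a • p.2)
  map_add' p q := by ext <;> simp <;> ring
  map_smul' c p := by ext <;> simp <;> ring

theorem reflection₂_apply (a b : ℝ) (p : ℂ × ℂ) :
    reflection₂ a b p = (a • p.1 + b • p.2, b • p.1 - a • p.2) := rfl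

theorem Complex.norm_sq_eq_re_im (z : ℂ) : ‖z‖ ^ 2 = z.re ^ 2 + z.im ^ 2 := by
  rw [Complex.sq_norm, Complex.normSq_apply]
  ring

theorem measurePreserving_reflection₂ {a b : ℝ} (hab : a ^ 2 + b ^ 2 = 1) :
    MeasurePreserving (reflection₂ a b) ((complexGaussian 1).prod (complexGaussian 1))
      ((complexGaussian 1).prod (complexGaussian 1)) := by
  have hinv : Function.Involutive (reflection₂ a b) := by
    intro p
    simp only [reflection₂_apply]
    have habC : (a : ℂ) ^ 2 + (b : ℂ) ^ 2 = 1 := by exact_mod_cast hab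
    simp only [Complex.real_smul]
    ext1
    · linear_combination p.1 * habC
    · linear_combination p.2 * habC
  have h := ((reflection₂ a b).measurePreserving_of_involutive
    ((volume : Measure ℂ).prod volume) hinv).withDensity_comp
    (g := fun p => ENNReal.ofReal ((π ^ 2)⁻¹ * Real.exp (-(‖p.1‖ ^ 2 + ‖p.2‖ ^ 2))))
    (by fun_prop)
  rw [complexGaussian_one_prod]
  have hnorm (p : ℂ × ℂ) :
      ‖(reflection₂ a b p).1‖ ^ 2 + ‖(reflection₂ a b p).2‖ ^ 2 = ‖p.1‖ ^ 2 + ‖p.2‖ ^ 2 := by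
    simp only [reflection₂_apply, Complex.norm_sq_eq_re_im, Complex.add_re, Complex.add_im,
      Complex.sub_re, Complex.sub_im, Complex.smul_re, Complex.smul_im, smul_eq_mul]
    linear_combination (p.1.re ^ 2 + p.1.im ^ 2 + p.2.re ^ 2 + p.2.im ^ 2) * hab
  simpa only [hnorm] using h

/-- A linear change of variables that turns independent standard complex Gaussians into an
input and a noise coordinate and diagonalises the quadratic form `zetaTerm ρ`. -/
theorem exists_measurePreserving_zetaTerm {ρ : ℝ} (hρ : 0 < ρ) :
    ∃ T : ℂ × ℂ → ℂ × ℂ,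
      MeasurePreserving T ((complexGaussian 1).prod (complexGaussian 1))
        ((complexGaussian ρ).prod (complexGaussian 1)) ∧
      ∀ p, zetaTerm ρ (T p).1 (T p).2 = √(ρ / (1 + ρ)) * (‖p.1‖ ^ 2 - ‖p.2‖ ^ 2) := by
  have hρ' : 0 < 1 + ρ := by linarith
  set l := √(ρ / (1 + ρ)) with hl
  have hl2 : l ^ 2 = ρ / (1 + ρ) := Real.sq_sqrt (by positivity)
  have hl0 : 0 < l := Real.sqrt_pos.2 (by positivity)
  have hl1 : l < 1 := by
    have : l ^ 2 < 1 := by rw [hl2, div_lt_one hρ']; linarith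
    nlinarith
  set a := √((1 + l) / 2)
  set b := √((1 - l) / 2)
  have ha : a ^ 2 = (1 + l) / 2 := Real.sq_sqrt (by linarith)
  have hb : b ^ 2 = (1 - l) / 2 := Real.sq_sqrt (by linarith)
  have hs : √ρ ^ 2 = ρ := Real.sq_sqrt hρ.le
  have hlρ : l ^ 2 * (1 + ρ) = ρ := by rw [hl2]; field_simp
  have hmu : √ρ * (2 * (a * b)) = l := by
    have hpos : 0 ≤ √ρ * (2 * (a * b)) := by positivity
    have hsq : (√ρ * (2 * (a * b))) ^ 2 = l ^ 2 := by
      rw [mul_pow, mul_pow, mul_pow, hs, ha, hb]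
      linear_combination -hlρ
    exact (pow_left_inj₀ hpos hl0.le two_ne_zero).1 hsq
  refine ⟨fun p => (√ρ • (reflection₂ a b p).1, (reflection₂ a b p).2), ?_, fun p => ?_⟩
  · exact ((measurePreserving_sqrt_smul_complexGaussian hρ).prod
      (MeasurePreserving.id (complexGaussian 1))).comp
      (measurePreserving_reflection₂ (by rw [ha, hb]; ring))
  · have hscaled : zetaTerm ρ (√ρ • (reflection₂ a b p).1) (reflection₂ a b p).2 * (1 + ρ) =
        l * (‖p.1‖ ^ 2 - ‖p.2‖ ^ 2) * (1 + ρ) := by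
      unfold zetaTerm
      field_simp
      simp only [reflection₂_apply, Complex.norm_sq_eq_re_im, Complex.add_re, Complex.add_im,
        Complex.sub_re, Complex.sub_im, Complex.smul_re, Complex.smul_im, smul_eq_mul,
        Complex.mul_re, Complex.conj_re, Complex.conj_im]
      linear_combination ((a * p.1.re + b * p.2.re) ^ 2 + (a * p.1.im + b * p.2.im) ^ 2
          - 4 * a * b * (p.1.re * p.2.re + p.1.im * p.2.im)) * hs
        + (ρ * (p.1.re ^ 2 + p.1.im ^ 2 - p.2.re ^ 2 - p.2.im ^ 2)
          - 2 * √ρ * (p.1.re * p.2.re + p.1.im * p.2.im)) * (ha - hb)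
        + (p.1.re ^ 2 + p.1.im ^ 2 - p.2.re ^ 2 - p.2.im ^ 2
          + 2 * √ρ * (p.1.re * p.2.re + p.1.im * p.2.im)) * hmu
    exact mul_right_cancel₀ hρ'.ne' hscaled

theorem integral_comp_norm_sq_complexGaussian (f : ℝ → ℝ) :
    ∫ u, f (‖u‖ ^ 2) ∂complexGaussian 1 = ∫ t in Set.Ioi (0 : ℝ), f t * Real.exp (-t) := by
  unfold complexGaussian
  rw [integral_withDensity_eq_integral_toReal_smul (by fun_prop) (by simp),
    ← integral_comp_rpow_Ioi_of_pos (g := fun t => f t * Real.exp (-t)) zero_lt_two]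
  have h := integral_fun_norm_addHaar (volume : Measure ℂ)
    (fun r => (π * 1)⁻¹ * Real.exp (-r ^ 2 / 1) * f (r ^ 2))
  have hdens (u : ℂ) : (ENNReal.ofReal ((π * 1)⁻¹ * Real.exp (-‖u‖ ^ 2 / 1))).toReal =
      (π * 1)⁻¹ * Real.exp (-‖u‖ ^ 2 / 1) := ENNReal.toReal_ofReal (by positivity)
  simp only [hdens, smul_eq_mul]
  rw [h, Complex.finrank_real_complex, measureReal_def, Complex.volume_ball]
  simp only [nsmul_eq_mul, smul_eq_mul]
  rw [← integral_const_mul, ← integral_const_mul]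
  refine setIntegral_congr_fun measurableSet_Ioi fun r hr => ?_
  norm_num
  field_simp

theorem integrable_comp_norm_sq_complexGaussian {f : ℝ → ℝ} :
    Integrable (fun u => f (‖u‖ ^ 2)) (complexGaussian 1) ↔
      IntegrableOn (fun t => f t * Real.exp (-t)) (Set.Ioi 0) := by
  unfold complexGaussian
  rw [integrable_withDensity_iff_integrable_smul' (by fun_prop) (by simp),
    ← integrableOn_Ioi_comp_rpow_iff' (fun t => f t * Real.exp (-t)) two_ne_zero]
  have h := integrable_fun_norm_addHaar (volume : Measure ℂ)
    (f := fun r => (π * 1)⁻¹ * Real.exp (-r ^ 2 / 1) * f (r ^ 2))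
  have hdens (u : ℂ) : (ENNReal.ofReal ((π * 1)⁻¹ * Real.exp (-‖u‖ ^ 2 / 1))).toReal =
      (π * 1)⁻¹ * Real.exp (-‖u‖ ^ 2 / 1) := ENNReal.toReal_ofReal (by positivity)
  simp only [hdens, smul_eq_mul]
  rw [h, Complex.finrank_real_complex, IntegrableOn, IntegrableOn,
    ← integrable_const_mul_iff (c := π) (by simp [Real.pi_ne_zero])]
  refine integrable_congr ((ae_restrict_mem measurableSet_Ioi).mono fun r hr => ?_)
  norm_num
  field_simp

theorem integrableOn_pow_mul_exp_neg (k : ℕ) :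
    IntegrableOn (fun t : ℝ => t ^ k * Real.exp (-t)) (Set.Ioi 0) := by
  refine (Real.GammaIntegral_convergent (s := k + 1) (by positivity)).congr_fun
    (fun t _ => ?_) measurableSet_Ioi
  simp [mul_comm]

theorem integral_pow_mul_exp_neg (k : ℕ) :
    ∫ t in Set.Ioi (0 : ℝ), t ^ k * Real.exp (-t) = k.factorial := by
  rw [← Real.Gamma_nat_eq_factorial, Real.Gamma_eq_integral (by positivity)]
  refine setIntegral_congr_fun measurableSet_Ioi fun t _ => ?_
  simp [mul_comm]

theorem integrable_norm_pow_complexGaussian (k : ℕ) :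
    Integrable (fun u => (‖u‖ ^ 2) ^ k) (complexGaussian 1) :=
  (integrable_comp_norm_sq_complexGaussian (f := fun t => t ^ k)).2
    (integrableOn_pow_mul_exp_neg k)

theorem integral_norm_pow_complexGaussian (k : ℕ) :
    ∫ u, (‖u‖ ^ 2) ^ k ∂complexGaussian 1 = k.factorial :=
  (integral_comp_norm_sq_complexGaussian fun t => t ^ k).trans (integral_pow_mul_exp_neg k)

theorem integrable_norm_pow_mul_norm_pow (j k : ℕ) :
    Integrable (fun p : ℂ × ℂ => (‖p.1‖ ^ 2) ^ j * (‖p.2‖ ^ 2) ^ k)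
      ((complexGaussian 1).prod (complexGaussian 1)) :=
  (integrable_norm_pow_complexGaussian j).mul_prod (integrable_norm_pow_complexGaussian k)

theorem integral_norm_pow_mul_norm_pow (j k : ℕ) :
    ∫ p : ℂ × ℂ, (‖p.1‖ ^ 2) ^ j * (‖p.2‖ ^ 2) ^ k
      ∂((complexGaussian 1).prod (complexGaussian 1)) = j.factorial * k.factorial := by
  rw [integral_prod_mul (fun u : ℂ => (‖u‖ ^ 2) ^ j) (fun u : ℂ => (‖u‖ ^ 2) ^ k),
    integral_norm_pow_complexGaussian, integral_norm_pow_complexGaussian]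

theorem integral_norm_sq_sub_norm_sq :
    ∫ p : ℂ × ℂ, (‖p.1‖ ^ 2 - ‖p.2‖ ^ 2)
      ∂((complexGaussian 1).prod (complexGaussian 1)) = 0 := by
  have h := integral_sub (integrable_norm_pow_mul_norm_pow 1 0)
    (integrable_norm_pow_mul_norm_pow 0 1)
  rw [integral_norm_pow_mul_norm_pow, integral_norm_pow_mul_norm_pow] at h
  simpa using h

theorem integral_norm_sq_sub_norm_sq_sq :
    ∫ p : ℂ × ℂ, (‖p.1‖ ^ 2 - ‖p.2‖ ^ 2) ^ 2
      ∂((complexGaussian 1).prod (complexGaussian 1)) = 2 := by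
  have hexp (p : ℂ × ℂ) : (‖p.1‖ ^ 2 - ‖p.2‖ ^ 2) ^ 2 =
      ((‖p.1‖ ^ 2) ^ 2 * (‖p.2‖ ^ 2) ^ 0 - 2 * ((‖p.1‖ ^ 2) ^ 1 * (‖p.2‖ ^ 2) ^ 1))
        + (‖p.1‖ ^ 2) ^ 0 * (‖p.2‖ ^ 2) ^ 2 := by ring
  simp_rw [hexp]
  rw [integral_add ((integrable_norm_pow_mul_norm_pow 2 0).sub'
      ((integrable_norm_pow_mul_norm_pow 1 1).const_mul 2))
      (integrable_norm_pow_mul_norm_pow 0 2),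
    integral_sub (integrable_norm_pow_mul_norm_pow 2 0)
      ((integrable_norm_pow_mul_norm_pow 1 1).const_mul 2),
    integral_const_mul]
  simp only [integral_norm_pow_mul_norm_pow]
  norm_num [Nat.factorial]

theorem measurePreserving_sub_right_restrict_Ioi (t : ℝ) :
    MeasurePreserving (fun s : ℝ => s - t) (volume.restrict (Set.Ioi t))
      (volume.restrict (Set.Ioi 0)) := by
  have h := (measurePreserving_sub_right (volume : Measure ℝ) t).restrict_preimage
    (measurableSet_Ioi (a := (0 : ℝ)))
  simpa using h

theorem integrableOn_Ioi_sub_pow_mul_exp_neg (t : ℝ) (k : ℕ) :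
    IntegrableOn (fun s => (s - t) ^ k * Real.exp (-s)) (Set.Ioi t) := by
  have h := ((measurePreserving_sub_right_restrict_Ioi t).integrable_comp_of_integrable
    (integrableOn_pow_mul_exp_neg k)).const_mul (Real.exp (-t))
  refine h.congr (Filter.Eventually.of_forall fun s => ?_)
  have hs : Real.exp (-s) = Real.exp (-t) * Real.exp (-(s - t)) := by
    rw [← Real.exp_add]; congr 1; ring
  simp only [Function.comp_apply, hs]
  ring

theorem integral_Ioi_sub_pow_mul_exp_neg (t : ℝ) (k : ℕ) :
    ∫ s in Set.Ioi t, (s - t) ^ k * Real.exp (-s) = k.factorial * Real.exp (-t) := by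
  have h := (measurePreserving_sub_right_restrict_Ioi t).integral_comp
    (MeasurableEquiv.subRight t).measurableEmbedding fun s => s ^ k * Real.exp (-s)
  rw [← integral_pow_mul_exp_neg k, ← h, ← integral_mul_const]
  refine integral_congr_ae (Filter.Eventually.of_forall fun s => ?_)
  have hs : Real.exp (-s) = Real.exp (-t) * Real.exp (-(s - t)) := by
    rw [← Real.exp_add]; congr 1; ring
  simp only [hs]
  ring

theorem integral_abs_sub_cube_mul_exp_neg {t : ℝ} (ht : 0 ≤ t) :
    ∫ s in Set.Ioi (0 : ℝ), |t - s| ^ 3 * Real.exp (-s) =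
      t ^ 3 - 3 * t ^ 2 + 6 * t - 6 + 12 * Real.exp (-t) := by
  have hsplit (s : ℝ) : |t - s| ^ 3 * Real.exp (-s) =
      t ^ 3 * (s ^ 0 * Real.exp (-s)) - 3 * t ^ 2 * (s ^ 1 * Real.exp (-s))
        + 3 * t * (s ^ 2 * Real.exp (-s)) - s ^ 3 * Real.exp (-s)
        + 2 * (Set.Ioi t).indicator (fun s => (s - t) ^ 3 * Real.exp (-s)) s := by
    by_cases hs : t < s
    · rw [Set.indicator_of_mem (Set.mem_Ioi.2 hs), abs_of_neg (by linarith)]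
      ring
    · rw [Set.indicator_of_notMem (by simpa using hs), abs_of_nonneg (by linarith)]
      ring
  have hsub : Set.Ioi t ⊆ Set.Ioi 0 := Set.Ioi_subset_Ioi ht
  have hI (k : ℕ) : Integrable (fun s : ℝ => s ^ k * Real.exp (-s))
    (volume.restrict (Set.Ioi 0)) := integrableOn_pow_mul_exp_neg k
  have hind : Integrable ((Set.Ioi t).indicator fun s => (s - t) ^ 3 * Real.exp (-s))
      (volume.restrict (Set.Ioi 0)) := by
    refine ((integrable_indicator_iff measurableSet_Ioi).2
      (integrableOn_Ioi_sub_pow_mul_exp_neg t 3)).restrict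
  simp_rw [hsplit]
  rw [integral_add (((((hI 0).const_mul _).sub' ((hI 1).const_mul _)).fun_add
      ((hI 2).const_mul _)).sub' (hI 3)) (hind.const_mul 2),
    integral_sub ((((hI 0).const_mul _).sub' ((hI 1).const_mul _)).fun_add
      ((hI 2).const_mul _)) (hI 3),
    integral_add (((hI 0).const_mul _).sub' ((hI 1).const_mul _)) ((hI 2).const_mul _),
    integral_sub ((hI 0).const_mul _) ((hI 1).const_mul _)]
  simp only [integral_const_mul, integral_pow_mul_exp_neg]
  rw [setIntegral_indicator measurableSet_Ioi, Set.inter_eq_self_of_subset_right hsub,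
    integral_Ioi_sub_pow_mul_exp_neg]
  norm_num [Nat.factorial]
  ring

theorem integrable_exp_neg_norm_sq_complexGaussian :
    Integrable (fun u : ℂ => Real.exp (-‖u‖ ^ 2)) (complexGaussian 1) := by
  refine (integrable_comp_norm_sq_complexGaussian (f := fun t => Real.exp (-t))).2 ?_
  refine (integrableOn_exp_mul_Ioi (a := -2) (by norm_num) 0).congr_fun (fun t _ => ?_)
    measurableSet_Ioi
  simp only [← Real.exp_add]
  ring_nf

theorem integral_exp_neg_norm_sq_complexGaussian :
    ∫ u : ℂ, Real.exp (-‖u‖ ^ 2) ∂complexGaussian 1 = 1 / 2 := by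
  rw [integral_comp_norm_sq_complexGaussian fun t => Real.exp (-t)]
  have h := integral_exp_mul_Ioi (a := -2) (by norm_num) 0
  rw [show (1 / 2 : ℝ) = -Real.exp (-2 * 0) / -2 by norm_num, ← h]
  refine setIntegral_congr_fun measurableSet_Ioi fun t _ => ?_
  simp only [← Real.exp_add]
  ring_nf

theorem integrable_abs_norm_sq_sub_norm_sq_cube :
    Integrable (fun p : ℂ × ℂ => |‖p.1‖ ^ 2 - ‖p.2‖ ^ 2| ^ 3)
      ((complexGaussian 1).prod (complexGaussian 1)) := by
  refine (((integrable_norm_pow_mul_norm_pow 3 0).add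
    (integrable_norm_pow_mul_norm_pow 0 3)).const_mul 4).mono' (by fun_prop)
    (Filter.Eventually.of_forall fun p => ?_)
  simp only [Pi.add_apply, pow_zero, mul_one, one_mul, norm_pow, Real.norm_eq_abs, abs_abs]
  have hs : 0 ≤ ‖p.1‖ ^ 2 := by positivity
  have ht : 0 ≤ ‖p.2‖ ^ 2 := by positivity
  generalize ‖p.1‖ ^ 2 = s at *
  generalize ‖p.2‖ ^ 2 = t at *
  calc |s - t| ^ 3 ≤ (s + t) ^ 3 := by
        gcongr
        rw [abs_le]
        constructor <;> linarith
    _ ≤ 4 * (s ^ 3 + t ^ 3) := by nlinarith [mul_nonneg (add_nonneg hs ht) (sq_nonneg (s - t))]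

theorem integral_abs_norm_sq_sub_norm_sq_cube :
    ∫ p : ℂ × ℂ, |‖p.1‖ ^ 2 - ‖p.2‖ ^ 2| ^ 3
      ∂((complexGaussian 1).prod (complexGaussian 1)) = 6 := by
  have hI := integrable_norm_pow_complexGaussian
  rw [integral_prod _ integrable_abs_norm_sq_sub_norm_sq_cube]
  have hinner (u : ℂ) : ∫ v : ℂ, |‖u‖ ^ 2 - ‖v‖ ^ 2| ^ 3 ∂complexGaussian 1 =
      (‖u‖ ^ 2) ^ 3 - 3 * (‖u‖ ^ 2) ^ 2 + 6 * (‖u‖ ^ 2) ^ 1 - 6 * (‖u‖ ^ 2) ^ 0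
        + 12 * Real.exp (-‖u‖ ^ 2) := by
    rw [integral_comp_norm_sq_complexGaussian fun s => |‖u‖ ^ 2 - s| ^ 3,
      integral_abs_sub_cube_mul_exp_neg (by positivity)]
    ring
  simp_rw [hinner]
  rw [integral_add ((((hI 3).sub' ((hI 2).const_mul 3)).fun_add ((hI 1).const_mul 6)).sub'
      ((hI 0).const_mul 6)) (integrable_exp_neg_norm_sq_complexGaussian.const_mul 12),
    integral_sub (((hI 3).sub' ((hI 2).const_mul 3)).fun_add ((hI 1).const_mul 6))
      ((hI 0).const_mul 6),
    integral_add ((hI 3).sub' ((hI 2).const_mul 3)) ((hI 1).const_mul 6),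
    integral_sub (hI 3) ((hI 2).const_mul 3)]
  simp only [integral_const_mul, integral_norm_pow_complexGaussian,
    integral_exp_neg_norm_sq_complexGaussian]
  norm_num [Nat.factorial]

theorem log_Wdens_div_outDens {n : ℕ} {ρ : ℝ} (hρ : 0 < ρ) (x z : Fin n → ℂ) :
    Real.log (Wdens x (x + z) / outDens ρ (x + z)) =
      n * Real.log (1 + ρ) + ∑ i : Fin n, zetaTerm ρ (x i) (z i) := by
  have hρ' : 0 < 1 + ρ := by linarith
  have hterm (i : Fin n) : Real.log (π⁻¹ * Real.exp (-‖(x + z) i - x i‖ ^ 2) /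
      ((π * (1 + ρ))⁻¹ * Real.exp (-‖(x + z) i‖ ^ 2 / (1 + ρ)))) =
      Real.log (1 + ρ) + zetaTerm ρ (x i) (z i) := by
    have hratio : π⁻¹ * Real.exp (-‖(x + z) i - x i‖ ^ 2) /
        ((π * (1 + ρ))⁻¹ * Real.exp (-‖(x + z) i‖ ^ 2 / (1 + ρ))) =
        (1 + ρ) * Real.exp (zetaTerm ρ (x i) (z i)) := by
      have hz : zetaTerm ρ (x i) (z i) =
          -‖(x + z) i - x i‖ ^ 2 - -‖(x + z) i‖ ^ 2 / (1 + ρ) := by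
        unfold zetaTerm
        simp only [Pi.add_apply, add_sub_cancel_left, Complex.norm_sq_eq_re_im, Complex.add_re,
          Complex.add_im, Complex.mul_re, Complex.conj_re, Complex.conj_im]
        field_simp
        ring
      rw [hz, Real.exp_sub]
      field_simp
    rw [hratio, Real.log_mul hρ'.ne' (Real.exp_ne_zero _), Real.log_exp]
  unfold Wdens outDens
  rw [← Finset.prod_div_distrib, Real.log_prod fun i _ => by positivity]
  simp_rw [hterm, Finset.sum_add_distrib]
  simp

/-- For X ~ CN(0, ρIₙ), Z ~ CN(0, Iₙ) independent, Y = X + Z: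
(i) the information density ln(W(Y|X)/(P̄W)(Y)) equals n ln(1+ρ) + Σᵢ ζᵢ
pointwise; (ii) each ζ term, under the product law of an input and a noise
coordinate, is distributed as λ(|U|² - |V|²) for independent standard complex
Gaussians U, V with λ = √(ρ/(1+ρ)); (iii) E[ζ] = 0, Var(ζ) = 2ρ/(1+ρ), and
E[|ζ|³] = 6 (ρ/(1+ρ))^{3/2}. -/
theorem info_density_decomposition (n : ℕ) (hn : 1 ≤ n) (ρ : ℝ) (hρ : 0 < ρ) :
    (∀ x z : Fin n → ℂ,
      Real.log (Wdens x (x + z) / outDens ρ (x + z)) =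
        n * Real.log (1 + ρ) + ∑ i : Fin n, zetaTerm ρ (x i) (z i)) ∧
    (Measure.map (fun p : ℂ × ℂ => zetaTerm ρ p.1 p.2)
        ((complexGaussian ρ).prod (complexGaussian 1)) =
      Measure.map
        (fun p : ℂ × ℂ => Real.sqrt (ρ / (1 + ρ)) * (‖p.1‖ ^ 2 - ‖p.2‖ ^ 2))
        ((complexGaussian 1).prod (complexGaussian 1))) ∧
    (∫ p : ℂ × ℂ, zetaTerm ρ p.1 p.2
        ∂((complexGaussian ρ).prod (complexGaussian 1)) = 0) ∧
    (∫ p : ℂ × ℂ, (zetaTerm ρ p.1 p.2) ^ 2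
        ∂((complexGaussian ρ).prod (complexGaussian 1)) = 2 * ρ / (1 + ρ)) ∧
    (∫ p : ℂ × ℂ, |zetaTerm ρ p.1 p.2| ^ 3
        ∂((complexGaussian ρ).prod (complexGaussian 1)) =
      6 * (ρ / (1 + ρ)) ^ ((3:ℝ) / 2)) := by
  obtain ⟨T, hT, hζ⟩ := exists_measurePreserving_zetaTerm hρ
  have hmeas : Measurable fun p : ℂ × ℂ => zetaTerm ρ p.1 p.2 := by
    unfold zetaTerm
    fun_prop
  have hl2 : √(ρ / (1 + ρ)) ^ 2 = ρ / (1 + ρ) := Real.sq_sqrt (by positivity)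
  have hl3 : √(ρ / (1 + ρ)) ^ 3 = (ρ / (1 + ρ)) ^ ((3 : ℝ) / 2) := by
    rw [Real.sqrt_eq_rpow, ← Real.rpow_natCast, ← Real.rpow_mul (by positivity)]
    norm_num
  have hint (f : ℝ → ℝ) (hf : Measurable f) :
      ∫ p : ℂ × ℂ, f (zetaTerm ρ p.1 p.2) ∂((complexGaussian ρ).prod (complexGaussian 1)) =
        ∫ p : ℂ × ℂ, f (√(ρ / (1 + ρ)) * (‖p.1‖ ^ 2 - ‖p.2‖ ^ 2))
          ∂((complexGaussian 1).prod (complexGaussian 1)) := by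
    rw [← hT.map_eq, integral_map hT.aemeasurable
      (by exact (hf.comp hmeas).aestronglyMeasurable)]
    simp only [hζ]
  refine ⟨log_Wdens_div_outDens hρ, ?_, ?_, ?_, ?_⟩
  · rw [← hT.map_eq, Measure.map_map hmeas hT.measurable]
    exact congrArg (fun f => Measure.map f _) (funext hζ)
  · rw [hint (fun t => t) measurable_id, integral_const_mul, integral_norm_sq_sub_norm_sq,
      mul_zero]
  · rw [hint (fun t => t ^ 2) (by fun_prop)]
    simp only [mul_pow]
    rw [integral_const_mul, integral_norm_sq_sub_norm_sq_sq, hl2]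
    ring
  · rw [hint (fun t => |t| ^ 3) (by fun_prop)]
    simp only [abs_mul, mul_pow, abs_of_nonneg (Real.sqrt_nonneg _)]
    rw [integral_const_mul, integral_abs_norm_sq_sub_norm_sq_cube, hl3]
    ring
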